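/- Let X be a hypersurface of degree d and dimension n in P^{n+1} over F_q whose Thas invariant satisfies k_X ≤ n (equivalently, X(F_q) ≠ P^{n+1}(F_q)). Then N_q(X) ≤ d·q^n + N_q(P^{n−1}) (the Segre–Serre–Sørensen bound). -/

import Mathlib

/-- `NP q N` is the number of `F_q`-points of `P^N`, i.e. `q^N + q^(N-1) + … + q + 1`. -/
def NP (q N : ℕ) : ℕ := ∑ i ∈ Finset.range (N + 1), q ^ i

/-- `Theta q d n k` is the quantity `Θ_{n,k}^{d,q} = (d-1)·q^k·N_q(P^{n-k}) + N_q(P^k)`. -/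
def Theta (q d n k : ℕ) : ℕ := (d - 1) * q ^ k * NP q (n - k) + NP q k

/-- The number of `F`-rational points of the hypersurface `f = 0` in `P^{m-1}`. -/
noncomputable def numPoints {F : Type*} [Field F] {m : ℕ}
    (f : MvPolynomial (Fin m) F) : ℕ :=
  Nat.card {p : Projectivization F (Fin m → F) // MvPolynomial.eval p.rep f = 0}

/-- The projective linear subspace `P(W)` is contained in the hypersurface `f = 0`. -/
def SubInX {F : Type*} [Field F] {m : ℕ}
    (f : MvPolynomial (Fin m) F) (W : Submodule F (Fin m → F)) : Prop :=
  ∀ v ∈ W, MvPolynomial.eval v f = 0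

/-- The Thas invariant of the hypersurface `f = 0` equals `k`: there is an `F`-linear
projective subspace of dimension `k` contained in it, and none of dimension `k + 1`. -/
def ThasEq {F : Type*} [Field F] {m : ℕ}
    (f : MvPolynomial (Fin m) F) (k : ℕ) : Prop :=
  (∃ W : Submodule F (Fin m → F), Module.finrank F W = k + 1 ∧ SubInX f W) ∧
  ¬ ∃ W : Submodule F (Fin m → F), Module.finrank F W = k + 2 ∧ SubInX f W

/-- `v` is a homogeneous coordinate vector of a singular `F`-point of `f = 0`. -/
def IsSingPt {F : Type*} [Field F] {m : ℕ}
    (f : MvPolynomial (Fin m) F) (v : Fin m → F) : Prop :=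
  v ≠ 0 ∧ MvPolynomial.eval v f = 0 ∧
    ∀ i, MvPolynomial.eval v (MvPolynomial.pderiv i f) = 0

open Finset in
/-- The Schwartz–Zippel bound over a whole finite field, in multiplicative form. -/
lemma card_mul_card_zeros_le {F : Type*} [Field F] [Fintype F] [DecidableEq F] {m e : ℕ}
    {g : MvPolynomial (Fin m) F} (hg : g ≠ 0) (he : g.totalDegree ≤ e) :
    Fintype.card F * #{x : Fin m → F | MvPolynomial.eval x g = 0} ≤ e * Fintype.card F ^ m := by
  have h := MvPolynomial.schwartz_zippel_totalDegree hg (univ : Finset F)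
  have hq : (0 : ℚ≥0) < Fintype.card F := by exact_mod_cast Fintype.card_pos
  rw [Fintype.piFinset_univ, card_univ, div_le_div_iff₀ (by positivity) hq] at h
  have h' : #{x : Fin m → F | MvPolynomial.eval x g = 0} * Fintype.card F ≤
      g.totalDegree * Fintype.card F ^ m := by exact_mod_cast h
  rw [mul_comm]
  exact h'.trans (Nat.mul_le_mul_right _ he)

/-- Homogeneous polynomials may be pulled back along linear maps. -/
lemma MvPolynomial.IsHomogeneous.exists_comp_linearMap {F : Type*} [Field F] {k m d : ℕ}
    {f : MvPolynomial (Fin m) F} (hf : f.IsHomogeneous d)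
    (L : (Fin k → F) →ₗ[F] (Fin m → F)) :
    ∃ g : MvPolynomial (Fin k) F, g.IsHomogeneous d ∧
      ∀ x, MvPolynomial.eval x g = MvPolynomial.eval (L x) f := by
  refine ⟨MvPolynomial.aeval
    (fun i => ∑ j, MvPolynomial.C (L (Pi.single j 1) i) * MvPolynomial.X j) f, ?_, fun x => ?_⟩
  · have h := hf.aeval (n := 1)
      (fun i => ∑ j, MvPolynomial.C (L (Pi.single j 1) i) * MvPolynomial.X j) fun i =>
        MvPolynomial.IsHomogeneous.sum _ _ _ fun j _ => MvPolynomial.isHomogeneous_C_mul_X _ _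
    rwa [one_mul] at h
  · rw [MvPolynomial.aeval_def, MvPolynomial.algebraMap_eq, ← MvPolynomial.coe_eval₂Hom,
      MvPolynomial.map_eval₂Hom]
    have hL : (fun i => MvPolynomial.eval x
        (∑ j, MvPolynomial.C (L (Pi.single j 1) i) * MvPolynomial.X j)) = L x := by
      funext i
      rw [LinearMap.pi_apply_eq_sum_univ L x]
      simp only [map_sum, map_mul, MvPolynomial.eval_C, MvPolynomial.eval_X, Finset.sum_apply,
        Pi.smul_apply, smul_eq_mul]
      refine Finset.sum_congr rfl fun j _ => ?_
      rw [mul_comm]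
      have hj : (Pi.single j 1 : Fin k → F) = fun l => if j = l then 1 else 0 := by
        funext l
        simp [Pi.single_apply, eq_comm]
      rw [hj]
    rw [hL]
    have hC : (MvPolynomial.eval x).comp MvPolynomial.C = RingHom.id F := by ext; simp
    rw [hC]
    rfl

/-- A homogeneous polynomial of positive degree vanishes at the origin. -/
lemma MvPolynomial.IsHomogeneous.eval_zero_eq_zero {F σ : Type*} [Field F] {d : ℕ}
    {f : MvPolynomial σ F} (hf : f.IsHomogeneous d) (hd : 1 ≤ d) :
    MvPolynomial.eval (0 : σ → F) f = 0 := by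
  have h := hf.coeff_eq_zero (d := 0) (by simp; omega)
  simpa [MvPolynomial.eval_zero, MvPolynomial.constantCoeff_eq] using h

lemma MvPolynomial.IsHomogeneous.eval_smul_eq {F σ : Type*} [Field F] {d : ℕ}
    {f : MvPolynomial σ F} (hf : f.IsHomogeneous d) (c : F) (x : σ → F) :
    MvPolynomial.eval (c • x) f = c ^ d * MvPolynomial.eval x f := by
  simp only [MvPolynomial.eval_eq, Finset.mul_sum]
  refine Finset.sum_congr rfl fun s hs => ?_
  have hsd : ∑ i ∈ s.support, s i = d := by
    have := hf (MvPolynomial.mem_support_iff.mp hs)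
    rw [← this, Finsupp.weight_apply]
    simp [Finsupp.sum]
  simp only [Pi.smul_apply, smul_eq_mul, mul_pow, Finset.prod_mul_distrib,
    Finset.prod_pow_eq_pow_sum, hsd]
  ring

/-- A hyperplane has a linear parametrization. -/
lemma exists_hyperplane_param {F : Type*} [Field F] {m : ℕ} {a : Fin (m + 1) → F} (ha : a ≠ 0) :
    ∃ L : (Fin m → F) →ₗ[F] (Fin (m + 1) → F), Function.Injective L ∧
      ∀ x, a ⬝ᵥ x = 0 ↔ ∃ y, L y = x := by
  let l : (Fin (m + 1) → F) →ₗ[F] F := dotProductBilin F F a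
  have hl : l ≠ 0 := by
    intro h
    refine ha (dotProduct_eq_zero a fun w => ?_)
    exact congrArg (fun t => t w) h
  have hr : Module.finrank F (LinearMap.ker l) = m := by
    have h1 := l.finrank_range_add_finrank_ker
    rw [LinearMap.range_eq_top.mpr (LinearMap.surjective hl)] at h1
    simp at h1
    omega
  let e : (Fin m → F) ≃ₗ[F] LinearMap.ker l :=
    LinearEquiv.ofFinrankEq _ _ (by simp [hr])
  refine ⟨(LinearMap.ker l).subtype ∘ₗ e.toLinearMap, ?_, fun x => ⟨fun hx => ?_, ?_⟩⟩
  · exact Subtype.val_injective.comp e.injective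
  · exact ⟨e.symm ⟨x, hx⟩, by simp⟩
  · rintro ⟨y, rfl⟩
    exact (e y).2

open Finset in
lemma card_hyperplane {F : Type*} [Field F] [Fintype F] [DecidableEq F] {m : ℕ}
    {a : Fin (m + 1) → F} (ha : a ≠ 0) :
    #{x : Fin (m + 1) → F | a ⬝ᵥ x = 0} = Fintype.card F ^ m := by
  obtain ⟨L, hL, hr⟩ := exists_hyperplane_param ha
  have : ({x : Fin (m + 1) → F | a ⬝ᵥ x = 0} : Finset _) = univ.image L := by
    ext x
    simp [hr]
  rw [this, card_image_of_injective _ hL]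
  simp

open Finset in
/-- The bound for a cone containing the coordinate hyperplane `x₀ = 0`. -/
lemma card_zeros_le_of_coord {F : Type*} [Field F] [Fintype F] [DecidableEq F] {m d : ℕ}
    (hd : 1 ≤ d) (hdq : d ≤ Fintype.card F) {f : MvPolynomial (Fin (m + 1)) F}
    (hf : f.IsHomogeneous d) (hne : ∃ v, MvPolynomial.eval v f ≠ 0)
    (hv : ∀ y : Fin m → F, MvPolynomial.eval (Fin.cons 0 y) f = 0) :
    Fintype.card F * #{x : Fin (m + 1) → F | MvPolynomial.eval x f = 0} ≤
      Fintype.card F ^ m * (d * (Fintype.card F - 1) + 1) := by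
  set P := MvPolynomial.finSuccEquiv F m f with hP
  have hev : ∀ (c : F) (y : Fin m → F), MvPolynomial.eval (Fin.cons c y) f =
      Polynomial.eval c (Polynomial.map (MvPolynomial.eval y) P) := fun c y =>
    MvPolynomial.eval_eq_eval_mv_eval' y c f
  have h0 : P.coeff 0 = 0 := by
    refine (hf.finSuccEquiv_coeff_isHomogeneous 0 d (by simp)).eq_zero_of_forall_eval_eq_zero_of_le_card
      (fun r => ?_) (by simpa using hdq)
    have := hv r
    rw [hev, ← Polynomial.coeff_zero_eq_eval_zero, Polynomial.coeff_map] at this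
    exact this
  obtain ⟨Q, hQ⟩ := Polynomial.X_dvd_iff.mpr h0
  let g : F → MvPolynomial (Fin m) F := fun c => Q.eval (MvPolynomial.C c)
  have hg : ∀ c y, MvPolynomial.eval (Fin.cons c y) f = c * MvPolynomial.eval y (g c) := by
    intro c y
    rw [hev, hQ]
    simp only [Polynomial.map_mul, Polynomial.map_X, Polynomial.eval_mul, Polynomial.eval_X, g]
    congr 1
    rw [Polynomial.eval_map, ← Polynomial.eval₂_at_apply, MvPolynomial.eval_C]
  have hgdeg : ∀ c, (g c).totalDegree ≤ d - 1 := by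
    intro c
    simp only [g, Polynomial.eval_eq_sum, Polynomial.sum]
    refine MvPolynomial.totalDegree_finsetSum_le fun i hi => ?_
    have hi' : P.coeff (i + 1) ≠ 0 := by
      rw [hQ, Polynomial.coeff_X_mul]
      exact Polynomial.mem_support_iff.mp hi
    have h1 := MvPolynomial.totalDegree_coeff_finSuccEquiv_add_le f (i + 1) hi'
    have h2 := hf.totalDegree_le
    rw [← hP, hQ, Polynomial.coeff_X_mul] at h1
    rw [← MvPolynomial.C_pow]
    refine (MvPolynomial.totalDegree_mul _ _).trans ?_
    rw [MvPolynomial.totalDegree_C]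
    omega
  have hgne : ∀ c, c ≠ 0 → g c ≠ 0 := by
    intro c hc hgc
    obtain ⟨v, hv'⟩ := hne
    have hv0 : v 0 ≠ 0 := by
      intro h
      apply hv'
      rw [← Fin.cons_self_tail v, h]
      exact hv _
    have h1 := hf.eval_smul_eq (c / v 0) v
    rw [← Fin.cons_self_tail ((c / v 0) • v)] at h1
    simp only [Pi.smul_apply, smul_eq_mul, div_mul_cancel₀ _ hv0] at h1
    rw [hg, hgc, map_zero, mul_zero] at h1
    exact mul_ne_zero (pow_ne_zero _ (div_ne_zero hc hv0)) hv' h1.symm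
  have hcount : #{x : Fin (m + 1) → F | MvPolynomial.eval x f = 0} =
      ∑ c : F, #{y : Fin m → F | MvPolynomial.eval (Fin.cons c y : Fin (m + 1) → F) f = 0} := by
    rw [← card_sigma]
    refine card_bij' (fun x _ => ⟨x 0, Fin.tail x⟩) (fun z _ => Fin.cons z.1 z.2) ?_ ?_ ?_ ?_
    · intro x hx
      simpa using hx
    · intro z hz
      simpa using hz
    · intro x hx
      simp
    · intro z hz
      simp
  have hz : #{y : Fin m → F | MvPolynomial.eval (Fin.cons 0 y : Fin (m + 1) → F) f = 0} =
      Fintype.card F ^ m := by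
    simp [hv]
  rw [hcount, ← add_sum_erase _ _ (mem_univ (0 : F)), hz, mul_add, mul_sum]
  have hb : ∀ c ∈ univ.erase (0 : F), Fintype.card F *
      #{y : Fin m → F | MvPolynomial.eval (Fin.cons c y : Fin (m + 1) → F) f = 0} ≤
        (d - 1) * Fintype.card F ^ m := by
    intro c hc
    have hc0 : c ≠ 0 := ne_of_mem_erase hc
    simp only [hg, mul_eq_zero, hc0, false_or]
    exact card_mul_card_zeros_le (hgne c hc0) (hgdeg c)
  refine (Nat.add_le_add_left (sum_le_card_nsmul _ _ _ hb) _).trans (le_of_eq ?_)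
  rw [card_erase_of_mem (mem_univ _), card_univ, smul_eq_mul]
  obtain ⟨s, hs⟩ : ∃ s, Fintype.card F = s + 1 := ⟨_, (Nat.sub_add_cancel Fintype.card_pos).symm⟩
  obtain ⟨e, rfl⟩ : ∃ e, d = e + 1 := ⟨d - 1, by omega⟩
  rw [hs]
  simp only [Nat.add_sub_cancel]
  ring

open Finset in
/-- The bound for a cone containing a hyperplane. -/
lemma card_zeros_le_of_hyperplane {F : Type*} [Field F] [Fintype F] [DecidableEq F] {m d : ℕ}
    (hd : 1 ≤ d) (hdq : d ≤ Fintype.card F) {f : MvPolynomial (Fin (m + 1)) F}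
    (hf : f.IsHomogeneous d) (hne : ∃ v, MvPolynomial.eval v f ≠ 0)
    {a : Fin (m + 1) → F} (ha : a ≠ 0)
    (hv : ∀ x, a ⬝ᵥ x = 0 → MvPolynomial.eval x f = 0) :
    Fintype.card F * #{x : Fin (m + 1) → F | MvPolynomial.eval x f = 0} ≤
      Fintype.card F ^ m * (d * (Fintype.card F - 1) + 1) := by
  obtain ⟨L, hL, hr⟩ := exists_hyperplane_param ha
  obtain ⟨u, hu⟩ : ∃ u, a ⬝ᵥ u ≠ 0 := by
    by_contra! h
    exact ha (dotProduct_eq_zero a h)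
  let E : (Fin (m + 1) → F) →ₗ[F] (Fin (m + 1) → F) :=
    (LinearMap.proj 0).smulRight u + L ∘ₗ LinearMap.funLeft F F Fin.succ
  have hE : ∀ x, E x = x 0 • u + L (Fin.tail x) := fun x => rfl
  have hEinj : Function.Injective E := by
    rw [injective_iff_map_eq_zero]
    intro x hx
    rw [hE] at hx
    have h1 := congrArg (fun t => a ⬝ᵥ t) hx
    simp only [dotProduct_add, dotProduct_smul, (hr _).mpr ⟨_, rfl⟩, dotProduct_zero, add_zero,
      smul_eq_mul, mul_eq_zero, hu, or_false] at h1
    rw [h1, zero_smul, zero_add] at hx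
    have h2 := hL (hx.trans (map_zero L).symm)
    rw [← Fin.cons_self_tail x, h1, h2]
    funext i
    refine Fin.cases ?_ (fun j => ?_) i <;> simp
  have hEbij : Function.Bijective E := Finite.injective_iff_bijective.mp hEinj
  obtain ⟨g, hg, hge⟩ := hf.exists_comp_linearMap E
  have hcard : #{x : Fin (m + 1) → F | MvPolynomial.eval x g = 0} =
      #{x : Fin (m + 1) → F | MvPolynomial.eval x f = 0} := by
    refine card_bij (fun x _ => E x) ?_ (fun _ _ _ _ h => hEinj h) ?_
    · intro x hx
      simpa [hge] using hx
    · intro y hy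
      obtain ⟨x, rfl⟩ := hEbij.2 y
      exact ⟨x, by simpa [hge] using hy, rfl⟩
  rw [← hcard]
  refine card_zeros_le_of_coord hd hdq hg ?_ fun y => ?_
  · obtain ⟨v, hv'⟩ := hne
    obtain ⟨x, rfl⟩ := hEbij.2 v
    exact ⟨x, by rwa [hge]⟩
  · rw [hge, hE]
    refine hv _ ((hr _).mpr ⟨y, ?_⟩)
    simp

open Finset in
/-- Double counting of incidences between the zeros of `f` and the linear hyperplanes. -/
lemma card_zeros_double_count {F : Type*} [Field F] [Fintype F] [DecidableEq F] {m B : ℕ}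
    {f : MvPolynomial (Fin (m + 1)) F} (h0 : MvPolynomial.eval 0 f = 0)
    (hB : ∀ a : Fin (m + 1) → F, a ≠ 0 →
      #{x : Fin (m + 1) → F | MvPolynomial.eval x f = 0 ∧ a ⬝ᵥ x = 0} ≤ B) :
    (#{x : Fin (m + 1) → F | MvPolynomial.eval x f = 0} - 1) * Fintype.card F ^ m +
        Fintype.card F ^ (m + 1) ≤
      #{x : Fin (m + 1) → F | MvPolynomial.eval x f = 0} +
        (Fintype.card F ^ (m + 1) - 1) * B := by
  set Z : Finset (Fin (m + 1) → F) := {x | MvPolynomial.eval x f = 0} with hZ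
  have hZ0 : (0 : Fin (m + 1) → F) ∈ Z := by rwa [hZ, mem_filter_univ]
  have hdc := sum_card_bipartiteAbove_eq_sum_card_bipartiteBelow
    (s := Z) (t := (univ : Finset (Fin (m + 1) → F))) (fun x a => a ⬝ᵥ x = 0)
  have hleft : ∑ x ∈ Z, #(bipartiteAbove (fun x a : Fin (m + 1) → F => a ⬝ᵥ x = 0) univ x) =
      (#Z - 1) * Fintype.card F ^ m + Fintype.card F ^ (m + 1) := by
    rw [← sum_erase_add _ _ hZ0]
    congr 1
    · rw [sum_const_nat (m := Fintype.card F ^ m), card_erase_of_mem hZ0]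
      intro x hx
      rw [← card_hyperplane (ne_of_mem_erase hx)]
      simp only [bipartiteAbove, dotProduct_comm]
    · simp [bipartiteAbove]
  rw [← hleft, hdc, ← add_sum_erase _ _ (mem_univ (0 : Fin (m + 1) → F))]
  refine Nat.add_le_add (by simp [bipartiteBelow]) ?_
  have hcard : #(univ.erase (0 : Fin (m + 1) → F)) = Fintype.card F ^ (m + 1) - 1 := by
    rw [card_erase_of_mem (mem_univ _)]
    simp
  rw [← hcard, ← smul_eq_mul]
  refine sum_le_card_nsmul _ _ _ fun a ha => ?_
  refine le_trans (le_of_eq ?_) (hB a (ne_of_mem_erase ha))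
  simp only [bipartiteBelow, hZ, filter_filter]

open Finset in
/-- Serre's bound for the affine cone over a hypersurface of degree at most `q`. -/
lemma card_zeros_le_of_degree_le {F : Type*} [Field F] [Fintype F] [DecidableEq F] {d : ℕ}
    (hd : 1 ≤ d) (hdq : d ≤ Fintype.card F) (m : ℕ) {f : MvPolynomial (Fin (m + 1)) F}
    (hf : f.IsHomogeneous d) (hne : ∃ v, MvPolynomial.eval v f ≠ 0) :
    Fintype.card F * #{x : Fin (m + 1) → F | MvPolynomial.eval x f = 0} ≤
      Fintype.card F ^ m * (d * (Fintype.card F - 1) + 1) := by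
  induction m with
  | zero =>
    refine card_zeros_le_of_hyperplane hd hdq hf hne (a := 1) one_ne_zero fun x hx => ?_
    have : x = 0 := by
      funext i
      fin_cases i
      simpa [dotProduct] using hx
    rw [this]
    exact hf.eval_zero_eq_zero hd
  | succ j ih =>
    by_cases hH : ∃ a : Fin (j + 2) → F, a ≠ 0 ∧ ∀ x, a ⬝ᵥ x = 0 → MvPolynomial.eval x f = 0
    · obtain ⟨a, ha, hv⟩ := hH
      exact card_zeros_le_of_hyperplane hd hdq hf hne ha hv
    push Not at hH
    set q := Fintype.card F with hq
    have hq1 : 1 < q := Fintype.one_lt_card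
    set R := q ^ j * (d * (q - 1) + 1) with hR
    have hB : ∀ a : Fin (j + 2) → F, a ≠ 0 →
        #{x : Fin (j + 2) → F | MvPolynomial.eval x f = 0 ∧ a ⬝ᵥ x = 0} ≤ R / q := by
      intro a ha
      obtain ⟨L, hL, hr⟩ := exists_hyperplane_param ha
      obtain ⟨g, hg, hge⟩ := hf.exists_comp_linearMap L
      have hcard : #{x : Fin (j + 1) → F | MvPolynomial.eval x g = 0} =
          #{x : Fin (j + 2) → F | MvPolynomial.eval x f = 0 ∧ a ⬝ᵥ x = 0} := by
        refine card_bij (fun x _ => L x) ?_ (fun _ _ _ _ h => hL h) ?_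
        · intro x hx
          simp only [mem_filter, mem_univ, true_and, hge] at hx ⊢
          exact ⟨hx, (hr _).mpr ⟨x, rfl⟩⟩
        · intro y hy
          simp only [mem_filter, mem_univ, true_and] at hy
          obtain ⟨x, rfl⟩ := (hr y).mp hy.2
          exact ⟨x, by simpa [hge] using hy.1, rfl⟩
      rw [← hcard, Nat.le_div_iff_mul_le (by omega), mul_comm]
      refine ih hg ?_
      obtain ⟨v, hv, hv'⟩ := hH a ha
      obtain ⟨x, rfl⟩ := (hr v).mp hv
      exact ⟨x, by rwa [hge]⟩
    have h := card_zeros_double_count (hf.eval_zero_eq_zero hd) hB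
    rw [← hq] at h
    set Z := #{x : Fin (j + 1 + 1) → F | MvPolynomial.eval x f = 0} with hZ
    have hZ1 : 1 ≤ Z := card_pos.mpr ⟨0, by rw [mem_filter_univ]; exact hf.eval_zero_eq_zero hd⟩
    have hBR : q * (R / q) ≤ R := Nat.mul_div_le R q
    have hRT : R ≤ q * q ^ (j + 1) := by
      rw [hR, pow_succ, mul_left_comm]
      refine Nat.mul_le_mul_left _ ?_
      have : d * (q - 1) ≤ q * (q - 1) := Nat.mul_le_mul_right _ hdq
      obtain ⟨s, hs⟩ : ∃ s, q = s + 1 := ⟨q - 1, by omega⟩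
      rw [hs] at this ⊢
      simp only [Nat.add_sub_cancel] at this ⊢
      nlinarith
    have hT : 1 < q ^ (j + 1) := Nat.one_lt_pow (by omega) hq1
    have goal' : q ^ (j + 1) * (d * (q - 1) + 1) = q * R := by rw [hR]; ring
    rw [goal']
    refine Nat.mul_le_mul_left _ ?_
    rw [pow_succ q (j + 1)] at h
    generalize q ^ (j + 1) = T at *
    generalize R / q = B at *
    clear_value q R Z
    have hTq : 1 ≤ T * q := Nat.mul_pos (by omega) (by omega)
    zify [hZ1, hTq] at *
    have h1 : (q : ℤ) * ((Z - 1) * (T - 1)) ≤ (T * q - 1) * (R - q) := by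
      have h3 : ((Z : ℤ) - 1) * (T - 1) ≤ (T * q - 1) * (B - 1) := by linarith
      have h4 : (0 : ℤ) ≤ T * q - 1 := by nlinarith
      calc (q : ℤ) * ((Z - 1) * (T - 1)) ≤ q * ((T * q - 1) * (B - 1)) :=
            mul_le_mul_of_nonneg_left h3 (by linarith)
        _ = (T * q - 1) * (q * B - q) := by ring
        _ ≤ (T * q - 1) * (R - q) := mul_le_mul_of_nonneg_left (by linarith) h4
    have h2 : ((q : ℤ) - 1) * (R - q) ≤ (q - 1) * (q * (T - 1)) :=
      mul_le_mul_of_nonneg_left (by linarith) (by linarith)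
    have hpos : (0 : ℤ) < q * (T - 1) := mul_pos (by linarith) (by linarith)
    refine le_of_mul_le_mul_left ?_ hpos
    nlinarith

open Finset in
/-- Serre's bound for the affine cone over a hypersurface. -/
lemma card_zeros_le {F : Type*} [Field F] [Fintype F] [DecidableEq F] {d n : ℕ}
    (hd : 1 ≤ d) {f : MvPolynomial (Fin (n + 2)) F}
    (hf : f.IsHomogeneous d) (hne : ∃ v, MvPolynomial.eval v f ≠ 0) :
    #{x : Fin (n + 2) → F | MvPolynomial.eval x f = 0} ≤
      Fintype.card F ^ n * (d * (Fintype.card F - 1) + 1) := by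
  rcases le_or_gt d (Fintype.card F) with hdq | hdq
  · have h := card_zeros_le_of_degree_le hd hdq (n + 1) hf hne
    rw [pow_succ', mul_assoc] at h
    exact Nat.le_of_mul_le_mul_left h Fintype.card_pos
  · refine (card_le_univ _).trans ?_
    rw [Fintype.card_fun, Fintype.card_fin, pow_add]
    refine Nat.mul_le_mul_left _ ?_
    obtain ⟨s, hs⟩ : ∃ s, Fintype.card F = s + 1 :=
      ⟨_, (Nat.sub_add_cancel Fintype.card_pos).symm⟩
    rw [hs] at hdq ⊢
    simp only [Nat.add_sub_cancel]
    nlinarith [Nat.mul_le_mul_right s hdq]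

open Finset in
/-- Each rational point of a hypersurface lifts to `q - 1` nonzero zeros of its equation. -/
lemma numPoints_mul_add_one_le {F : Type*} [Field F] [Fintype F] [DecidableEq F] {d m : ℕ}
    (hd : 1 ≤ d) {f : MvPolynomial (Fin m) F} (hf : f.IsHomogeneous d) :
    numPoints f * (Fintype.card F - 1) + 1 ≤
      #{x : Fin m → F | MvPolynomial.eval x f = 0} := by
  have h0 : (0 : Fin m → F) ∈ ({x | MvPolynomial.eval x f = 0} : Finset _) := by
    rw [mem_filter_univ]
    exact hf.eval_zero_eq_zero hd
  rw [← card_erase_add_one h0]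
  refine Nat.add_le_add_right ?_ 1
  have hsmul : ∀ (p : Projectivization F (Fin m → F)) (c : Fˣ),
      ∃ h : (c : F) • p.rep ≠ 0, Projectivization.mk F ((c : F) • p.rep) h = p := by
    intro p c
    have h : (c : F) • p.rep ≠ 0 := smul_ne_zero c.ne_zero p.rep_nonzero
    refine ⟨h, ?_⟩
    conv_rhs => rw [← p.mk_rep]
    exact (Projectivization.mk_eq_mk_iff' F _ _ _ _).mpr ⟨c, rfl⟩
  rw [← Fintype.card_units, ← Nat.card_eq_fintype_card, numPoints, ← Nat.card_prod,
    ← Nat.card_eq_finsetCard]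
  refine Nat.card_le_card_of_injective
    (fun z => ⟨(z.2 : F) • z.1.1.rep, ?_⟩) fun z w hzw => ?_
  · rw [mem_erase, mem_filter_univ]
    exact ⟨(hsmul _ _).1, by rw [hf.eval_smul_eq, z.1.2, mul_zero]⟩
  · have hzw' : (z.2 : F) • z.1.1.rep = (w.2 : F) • w.1.1.rep := congrArg Subtype.val hzw
    obtain ⟨hz, hz'⟩ := hsmul z.1.1 z.2
    obtain ⟨hw, hw'⟩ := hsmul w.1.1 w.2
    have hp : z.1 = w.1 := by
      refine Subtype.ext ?_
      rw [← hz', ← hw']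
      congr 1
    rw [hp] at hzw'
    exact Prod.ext hp (Units.ext (smul_left_injective F w.1.1.rep_nonzero hzw'))

theorem stmt3 {F : Type*} [Field F] [Fintype F] {n d : ℕ}
    (hn : 1 ≤ n) (hd : 2 ≤ d)
    (f : MvPolynomial (Fin (n + 2)) F) (hf0 : f ≠ 0) (hsq : Squarefree f)
    (hhom : f.IsHomogeneous d)
    (hfull : ¬ ∃ W : Submodule F (Fin (n + 2) → F), Module.finrank F W = n + 2 ∧ SubInX f W) :
    numPoints f ≤ d * Fintype.card F ^ n + NP (Fintype.card F) (n - 1) := by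
  classical
  have hne : ∃ v, MvPolynomial.eval v f ≠ 0 := by
    by_contra! h
    exact hfull ⟨⊤, by simp, fun v _ => h v⟩
  have h := (numPoints_mul_add_one_le (by omega) hhom).trans
    (card_zeros_le (by omega) hhom hne)
  have hq1 : 1 < Fintype.card F := Fintype.one_lt_card
  have hNP : NP (Fintype.card F) (n - 1) * (Fintype.card F - 1) + 1 = Fintype.card F ^ n := by
    rw [NP, Nat.sub_add_cancel hn]
    rw [geom_sum_mul_of_one_le hq1.le, Nat.sub_add_cancel (Nat.one_le_pow _ _ (by omega))]
  refine Nat.le_of_mul_le_mul_right (c := Fintype.card F - 1) ?_ (by omega)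
  rw [add_mul]
  have : d * Fintype.card F ^ n * (Fintype.card F - 1) =
    Fintype.card F ^ n * (d * (Fintype.card F - 1)) := by ring
  rw [mul_add, mul_one] at h
  omega
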